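/- arXiv:2511.21477 — 4 statements merged into one kernel-verified Lean document; each statement's English description precedes it below -/
import Mathlib

section
/- Let n, n', d be positive integers, let M ∈ ℝ^{n'×n} be a matrix with nonnegative entries whose rows each sum to 1 and whose columns each sum to at most 1, and let X ∈ ℝ^{n×d}. Then ‖H_c[MX]‖_F ≤ ‖H_c[X]‖_F, i.e., multiplication by a (sub)stochastic token-reduction matrix does not increase the high-frequency (mean-centered) component of the token matrix in Frobenius norm. -/
/-- Frobenius norm of a real matrix. -/
noncomputable def frobNorm {m d : ℕ} (Y : Matrix (Fin m) (Fin d) ℝ) : ℝ :=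
  Real.sqrt (∑ i, ∑ j, (Y i j) ^ 2)

/-- High-frequency (mean-centered) component: subtract the mean row from every row. -/
noncomputable def Hc {m d : ℕ} (Y : Matrix (Fin m) (Fin d) ℝ) : Matrix (Fin m) (Fin d) ℝ :=
  Y - Matrix.of fun _ j => (m : ℝ)⁻¹ * ∑ k, Y k j

theorem mean_min_aux {m : ℕ} (hm : 0 < m) (y : Fin m → ℝ) (c : ℝ) :
    ∑ i, (y i - (m : ℝ)⁻¹ * ∑ k, y k) ^ 2 ≤ ∑ i, (y i - c) ^ 2 := by
  have hm' : (m : ℝ) ≠ 0 := by positivity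
  set b := (m : ℝ)⁻¹ * ∑ k, y k with hb
  have hs : ∑ k, y k = m * b := by rw [hb]; field_simp
  have h : ∑ i, (y i - c) ^ 2 = ∑ i, (y i - b) ^ 2 + m * (b - c) ^ 2 := by
    have h1 : ∀ i, (y i - c) ^ 2 = (y i - b) ^ 2 + (2 * (b - c) * y i + (c ^ 2 - b ^ 2)) := by
      intro i; ring
    simp_rw [h1]
    rw [Finset.sum_add_distrib, Finset.sum_add_distrib, ← Finset.mul_sum, hs]
    simp
    ring
  rw [h]
  have : 0 ≤ (m : ℝ) * (b - c) ^ 2 := by positivity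
  linarith

theorem substochastic_reduction_nonincreasing_Hc
    {n n' d : ℕ} (hn : 0 < n) (hn' : 0 < n') (hd : 0 < d)
    (M : Matrix (Fin n') (Fin n) ℝ)
    (hM0 : ∀ j i, 0 ≤ M j i)
    (hMrow : ∀ j, ∑ i, M j i = 1)
    (hMcol : ∀ i, ∑ j, M j i ≤ 1)
    (X : Matrix (Fin n) (Fin d) ℝ) :
    frobNorm (Hc (M * X)) ≤ frobNorm (Hc X) := by
  unfold frobNorm
  apply Real.sqrt_le_sqrt
  rw [Finset.sum_comm, Finset.sum_comm (s := (Finset.univ : Finset (Fin n)))]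
  apply Finset.sum_le_sum
  intro j _
  simp only [Hc, Matrix.sub_apply, Matrix.of_apply]
  set c := (n : ℝ)⁻¹ * ∑ k, X k j
  refine (mean_min_aux hn' (fun i => (M * X) i j) c).trans ?_
  have h1 : ∀ i, ((M * X) i j - c) ^ 2 ≤ ∑ k, M i k * (X k j - c) ^ 2 := by
    intro i
    have h2 : (M * X) i j - c = ∑ k, M i k * (X k j - c) := by
      simp only [mul_sub, Finset.sum_sub_distrib, ← Finset.sum_mul, hMrow, one_mul,
        Matrix.mul_apply]
    rw [h2]
    have := (even_two.convexOn_pow (𝕜 := ℝ)).map_sum_le (t := Finset.univ) (w := M i)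
      (p := fun k => X k j - c) (fun k _ => hM0 i k) (hMrow i) (fun _ _ => Set.mem_univ _)
    simpa using this
  refine (Finset.sum_le_sum fun i _ => h1 i).trans ?_
  rw [Finset.sum_comm]
  apply Finset.sum_le_sum
  intro k _
  rw [← Finset.sum_mul]
  exact mul_le_of_le_one_left (sq_nonneg _) (hMcol k)
end

section
/- Let M ∈ ℝ^{n'×n} and A ∈ ℝ^{n'×n'} each have nonnegative entries, rows summing to 1, and columns summing to at most 1, and let X ∈ ℝ^{n×d}. Then ‖H_c[A·(M·X)]‖_F ≤ ‖H_c[M·X]‖_F ≤ ‖H_c[X]‖_F; i.e., applying a (sub)stochastic attention-type matrix after a token-reduction matrix yields a high-frequency component no larger than that of the original token matrix. -/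
theorem Hc_mul_le_aux {n m d : ℕ} (hm : 0 < m)
    (M : Matrix (Fin m) (Fin n) ℝ)
    (hM0 : ∀ j i, 0 ≤ M j i)
    (hMrow : ∀ j, ∑ i, M j i = 1)
    (hMcol : ∀ i, ∑ j, M j i ≤ 1)
    (X : Matrix (Fin n) (Fin d) ℝ) :
    frobNorm (Hc (M * X)) ≤ frobNorm (Hc X) := by
  unfold frobNorm
  apply Real.sqrt_le_sqrt
  rw [Finset.sum_comm, Finset.sum_comm (s := (Finset.univ : Finset (Fin n)))]
  apply Finset.sum_le_sum
  intro j _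
  simp only [Hc, Matrix.sub_apply, Matrix.of_apply]
  generalize (n : ℝ)⁻¹ * ∑ k, X k j = c
  refine (mean_min_aux hm (fun i => (M * X) i j) c).trans ?_
  calc ∑ i, ((M * X) i j - c) ^ 2 ≤ ∑ i, ∑ k, M i k * (X k j - c) ^ 2 := by
        apply Finset.sum_le_sum
        intro i _
        have h : (M * X) i j - c = ∑ k, M i k * (X k j - c) := by
          simp only [mul_sub, Finset.sum_sub_distrib, ← Finset.sum_mul, hMrow, one_mul,
            Matrix.mul_apply]
        rw [h]
        exact Real.pow_arith_mean_le_arith_mean_pow_of_even _ _ _ (fun k _ => hM0 i k)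
          (hMrow i) even_two
    _ = ∑ k, (∑ i, M i k) * (X k j - c) ^ 2 := by
        rw [Finset.sum_comm]; simp only [Finset.sum_mul]
    _ ≤ ∑ k, (X k j - c) ^ 2 := by
        apply Finset.sum_le_sum
        intro k _
        exact mul_le_of_le_one_left (sq_nonneg _) (hMcol k)

theorem attention_after_reduction_nonincreasing_Hc
    {n n' d : ℕ} (hn : 0 < n) (hn' : 0 < n')
    (M : Matrix (Fin n') (Fin n) ℝ)
    (hM0 : ∀ j i, 0 ≤ M j i)
    (hMrow : ∀ j, ∑ i, M j i = 1)
    (hMcol : ∀ i, ∑ j, M j i ≤ 1)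
    (A : Matrix (Fin n') (Fin n') ℝ)
    (hA0 : ∀ i j, 0 ≤ A i j)
    (hArow : ∀ i, ∑ j, A i j = 1)
    (hAcol : ∀ j, ∑ i, A i j ≤ 1)
    (X : Matrix (Fin n) (Fin d) ℝ) :
    frobNorm (Hc (A * (M * X))) ≤ frobNorm (Hc (M * X)) ∧
      frobNorm (Hc (M * X)) ≤ frobNorm (Hc X) := by
  exact ⟨Hc_mul_le_aux hn' A hA0 hArow hAcol _, Hc_mul_le_aux hn' M hM0 hMrow hMcol X⟩
end

section
/- Let M ∈ ℝ^{n'×n} have nonnegative entries, rows summing to 1, and columns summing to at most 1, let SA : ℝ^{n'×d} → ℝ^{n'×d} be a map and λ ∈ ℝ with 0 ≤ λ such that ‖H_c[SA(Y)]‖_F ≤ λ·‖H_c[Y]‖_F for all Y ∈ ℝ^{n'×d}. Then for every X ∈ ℝ^{n×d}, ‖H_c[SA(M·X)]‖_F ≤ λ·‖H_c[X]‖_F; i.e., token reduction composed with a λ-contractive self-attention layer attenuates the high-frequency component at least as fast as the self-attention layer alone. -/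
theorem aux_center {m : ℕ} (hm : 0 < m) (y : Fin m → ℝ) (c : ℝ) :
    ∑ k, (y k - (m : ℝ)⁻¹ * ∑ l, y l) ^ 2 ≤ ∑ k, (y k - c) ^ 2 := by
  have hm' : (m : ℝ) ≠ 0 := by positivity
  set a := (m : ℝ)⁻¹ * ∑ l, y l with ha
  have hs : ∑ l, y l = m * a := by rw [ha]; field_simp
  have h : ∑ k, (y k - c) ^ 2 = ∑ k, (y k - a) ^ 2 + m * (a - c) ^ 2 := by
    have e : ∀ k, (y k - c) ^ 2 = (y k - a) ^ 2 + (2 * (a - c) * y k + (c ^ 2 - a ^ 2)) := by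
      intro k; ring
    simp only [e, Finset.sum_add_distrib, ← Finset.mul_sum, hs, Finset.sum_const,
      Finset.card_univ, Fintype.card_fin, nsmul_eq_mul]
    ring
  rw [h]
  have : 0 ≤ (m : ℝ) * (a - c) ^ 2 := by positivity
  linarith

theorem aux_col {n n' : ℕ} (hn' : 0 < n')
    (M : Matrix (Fin n') (Fin n) ℝ)
    (hM0 : ∀ j i, 0 ≤ M j i)
    (hMrow : ∀ j, ∑ i, M j i = 1)
    (hMcol : ∀ i, ∑ j, M j i ≤ 1) (x : Fin n → ℝ) (c : ℝ) :
    ∑ k, ((∑ i, M k i * x i) - (n' : ℝ)⁻¹ * ∑ l, ∑ i, M l i * x i) ^ 2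
      ≤ ∑ i, (x i - c) ^ 2 := by
  refine (aux_center hn' (fun k => ∑ i, M k i * x i) c).trans ?_
  have h1 : ∀ k, ((∑ i, M k i * x i) - c) ^ 2 ≤ ∑ i, M k i * (x i - c) ^ 2 := by
    intro k
    have e : (∑ i, M k i * x i) - c = ∑ i, M k i * (x i - c) := by
      simp only [mul_sub, Finset.sum_sub_distrib, ← Finset.sum_mul, hMrow, one_mul]
    rw [e]
    exact Real.pow_arith_mean_le_arith_mean_pow_of_even Finset.univ _ _
      (fun i _ => hM0 k i) (hMrow k) even_two
  refine (Finset.sum_le_sum fun k _ => h1 k).trans ?_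
  rw [Finset.sum_comm]
  refine Finset.sum_le_sum fun i _ => ?_
  rw [← Finset.sum_mul]
  exact mul_le_of_le_one_left (sq_nonneg _) (hMcol i)

theorem reduction_then_contractive_SA
    {n n' d : ℕ} (hn : 0 < n) (hn' : 0 < n')
    (M : Matrix (Fin n') (Fin n) ℝ)
    (hM0 : ∀ j i, 0 ≤ M j i)
    (hMrow : ∀ j, ∑ i, M j i = 1)
    (hMcol : ∀ i, ∑ j, M j i ≤ 1)
    (SA : Matrix (Fin n') (Fin d) ℝ → Matrix (Fin n') (Fin d) ℝ)
    (lam : ℝ) (hlam : 0 ≤ lam)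
    (hSA : ∀ Y : Matrix (Fin n') (Fin d) ℝ, frobNorm (Hc (SA Y)) ≤ lam * frobNorm (Hc Y)) :
    ∀ X : Matrix (Fin n) (Fin d) ℝ,
      frobNorm (Hc (SA (M * X))) ≤ lam * frobNorm (Hc X) := by
  intro X
  refine (hSA _).trans (mul_le_mul_of_nonneg_left ?_ hlam)
  unfold frobNorm
  apply Real.sqrt_le_sqrt
  rw [Finset.sum_comm, Finset.sum_comm (f := fun i j => (Hc X i j) ^ 2)]
  refine Finset.sum_le_sum fun j _ => ?_
  simpa [Hc, Matrix.mul_apply] using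
    aux_col hn' M hM0 hMrow hMcol (fun i => X i j) ((n : ℝ)⁻¹ * ∑ k, X k j)
end

section
/- Let A ∈ ℝ^{n×n} have nonnegative entries, rows each summing to 1, and columns each summing to at most 1, and let X ∈ ℝ^{n×d}. Then the sequence ℓ ↦ ‖H_c[A^ℓ·X]‖_F is non-increasing in ℓ ∈ ℕ; i.e., repeated application of such an averaging matrix never increases the high-frequency component of the token matrix. -/
theorem var_min_aux {n : ℕ} (z : Fin n → ℝ) (c : ℝ) :
    ∑ i, (z i - (n : ℝ)⁻¹ * ∑ k, z k) ^ 2 ≤ ∑ i, (z i - c) ^ 2 := by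
  rcases Nat.eq_zero_or_pos n with rfl | hn
  · simp
  have hn' : (n : ℝ) ≠ 0 := by positivity
  obtain ⟨m, hm⟩ : ∃ m, m = (n : ℝ)⁻¹ * ∑ k, z k := ⟨_, rfl⟩
  have hs : ∑ k, z k = n * m := by rw [hm]; field_simp
  rw [← hm]
  have key : ∀ a : ℝ, ∑ i, (z i - a) ^ 2 = ∑ i, z i ^ 2 - 2 * a * (n * m) + n * a ^ 2 := by
    intro a
    rw [← hs, Finset.mul_sum]
    simp only [sub_sq, Finset.sum_add_distrib, Finset.sum_sub_distrib]
    simp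
    exact Finset.sum_congr rfl fun i _ => by ring
  rw [key, key]
  have : 0 ≤ (n : ℝ) * (m - c) ^ 2 := by positivity
  nlinarith

theorem col_aux {n : ℕ} (A : Matrix (Fin n) (Fin n) ℝ)
    (hA0 : ∀ i j, 0 ≤ A i j) (hArow : ∀ i, ∑ j, A i j = 1)
    (hAcol : ∀ j, ∑ i, A i j ≤ 1) (y : Fin n → ℝ) (c : ℝ) :
    ∑ i, ((∑ j, A i j * y j) - c) ^ 2 ≤ ∑ j, (y j - c) ^ 2 := by
  have h1 : ∀ i, ((∑ j, A i j * y j) - c) ^ 2 ≤ ∑ j, A i j * (y j - c) ^ 2 := by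
    intro i
    have e : (∑ j, A i j * y j) - c = ∑ j, A i j * (y j - c) := by
      simp only [mul_sub, Finset.sum_sub_distrib, ← Finset.sum_mul, hArow, one_mul]
    rw [e]
    have := Finset.sum_sq_le_sum_mul_sum_of_sq_eq_mul Finset.univ
      (r := fun j => A i j * (y j - c)) (f := fun j => A i j)
      (g := fun j => A i j * (y j - c) ^ 2) (fun j _ => hA0 i j)
      (fun j _ => mul_nonneg (hA0 i j) (sq_nonneg _)) (fun j _ => by ring)
    simpa [hArow] using this
  refine (Finset.sum_le_sum fun i _ => h1 i).trans ?_
  rw [Finset.sum_comm]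
  refine Finset.sum_le_sum fun j _ => ?_
  rw [← Finset.sum_mul]
  exact mul_le_of_le_one_left (sq_nonneg _) (hAcol j)

theorem iterated_averaging_nonincreasing_Hc
    {n d : ℕ}
    (A : Matrix (Fin n) (Fin n) ℝ)
    (hA0 : ∀ i j, 0 ≤ A i j)
    (hArow : ∀ i, ∑ j, A i j = 1)
    (hAcol : ∀ j, ∑ i, A i j ≤ 1)
    (X : Matrix (Fin n) (Fin d) ℝ) :
    Antitone (fun ℓ : ℕ => frobNorm (Hc (A ^ ℓ * X))) := by
  refine antitone_nat_of_succ_le fun l => ?_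
  simp only [pow_succ', Matrix.mul_assoc]
  generalize A ^ l * X = Y
  unfold frobNorm
  apply Real.sqrt_le_sqrt
  rw [Finset.sum_comm, Finset.sum_comm (γ := Fin n)]
  refine Finset.sum_le_sum fun j _ => ?_
  exact (var_min_aux (fun i => (A * Y) i j) ((n : ℝ)⁻¹ * ∑ k, Y k j)).trans
    (col_aux A hA0 hArow hAcol (fun i => Y i j) _)
end
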